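/- For every integer n ≥ 4 there exist a group G and an element g ∈ G such that g ∈ δ_n(G), g ∉ γ_n(G), and g² ∈ γ_n(G); that is, the dimension quotient δ_n(G)/γ_n(G) contains an element of order 2. -/

import Mathlib

/-- The augmentation ideal of the integral group ring `ℤG`: the kernel of the ring
homomorphism `ℤG → ℤ` sending each group element to `1`, viewed as a `ℤ`-submodule. -/
noncomputable def augIdeal (G : Type*) [Group G] : Submodule ℤ (MonoidAlgebra ℤ G) :=
  Submodule.restrictScalars ℤ
    (RingHom.ker ((MonoidAlgebra.lift ℤ ℤ G) 1).toRingHom)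

/-- The `n`-th dimension subgroup `δ_n(G) = {g ∈ G : g - 1 ∈ ϖ^n}`. -/
noncomputable def dimensionSubgroup (G : Type*) [Group G] (n : ℕ) : Set G :=
  {g : G | (MonoidAlgebra.of ℤ G g : MonoidAlgebra ℤ G) - 1 ∈ (augIdeal G) ^ n}

/-- `γ_n(G)`, the `n`-th term of the lower central series, with `γ_1(G) = G`. -/
def gammaGrp (G : Type*) [Group G] (n : ℕ) : Subgroup G := Subgroup.lowerCentralSeries (⊤ : Subgroup G) (n - 1)


section PartOne
open scoped commutatorElement
variable {G : Type} [Group G]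

noncomputable def dd (g : G) : MonoidAlgebra ℤ G := MonoidAlgebra.of ℤ G g - 1

theorem dd_one : dd (1 : G) = 0 := by rw [dd, map_one, sub_self]

theorem mem_aug_iff (x : MonoidAlgebra ℤ G) :
    x ∈ augIdeal G ↔ (MonoidAlgebra.lift ℤ ℤ G) 1 x = 0 := by
  unfold augIdeal
  rw [Submodule.restrictScalars_mem, RingHom.mem_ker]
  rfl

theorem dd_mem (g : G) : dd g ∈ augIdeal G := by
  rw [mem_aug_iff, dd, map_sub, MonoidAlgebra.lift_of]; simp

theorem aug_mul_left (r x : MonoidAlgebra ℤ G) (hx : x ∈ augIdeal G) : r * x ∈ augIdeal G := by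
  rw [mem_aug_iff] at *; rw [map_mul, hx, mul_zero]

theorem aug_mul_right (r x : MonoidAlgebra ℤ G) (hx : x ∈ augIdeal G) : x * r ∈ augIdeal G := by
  rw [mem_aug_iff] at *; rw [map_mul, hx, zero_mul]

theorem pw_mul {p q : ℕ} {x y : MonoidAlgebra ℤ G} (hx : x ∈ augIdeal G ^ p)
    (hy : y ∈ augIdeal G ^ q) : x * y ∈ augIdeal G ^ (p + q) := by
  rw [pow_add]; exact Submodule.mul_mem_mul hx hy

theorem pw_left {p : ℕ} (hp : 1 ≤ p) (r : MonoidAlgebra ℤ G) {x : MonoidAlgebra ℤ G}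
    (hx : x ∈ augIdeal G ^ p) : r * x ∈ augIdeal G ^ p := by
  obtain ⟨p, rfl⟩ := Nat.exists_eq_add_of_le' hp
  rw [pow_succ'] at hx ⊢
  refine Submodule.mul_induction_on hx ?_ ?_
  · intro m hm n hn
    rw [← mul_assoc]
    exact Submodule.mul_mem_mul (aug_mul_left r m hm) hn
  · intro x y hx hy
    rw [mul_add]; exact add_mem hx hy

theorem pw_right {p : ℕ} (hp : 1 ≤ p) (r : MonoidAlgebra ℤ G) {x : MonoidAlgebra ℤ G}
    (hx : x ∈ augIdeal G ^ p) : x * r ∈ augIdeal G ^ p := by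
  obtain ⟨p, rfl⟩ := Nat.exists_eq_add_of_le' hp
  rw [pow_succ] at hx ⊢
  refine Submodule.mul_induction_on hx ?_ ?_
  · intro m hm n hn
    rw [mul_assoc]
    exact Submodule.mul_mem_mul hm (aug_mul_right r n hn)
  · intro x y hx hy
    rw [add_mul]; exact add_mem hx hy

theorem pw_anti {p q : ℕ} (hp : 1 ≤ p) (hpq : p ≤ q) {x : MonoidAlgebra ℤ G}
    (hx : x ∈ augIdeal G ^ q) : x ∈ augIdeal G ^ p := by
  obtain ⟨d, rfl⟩ := Nat.exists_eq_add_of_le' hpq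
  rw [pow_add] at hx
  refine Submodule.mul_induction_on hx ?_ ?_
  · intro m hm n hn
    exact pw_left hp m hn
  · intro x y hx hy
    exact add_mem hx hy

theorem dd_pw1 (g : G) : dd g ∈ augIdeal G ^ 1 := by rw [pow_one]; exact dd_mem g

theorem dd_mul (g h : G) : dd (g * h) = dd g + dd h + dd g * dd h := by
  simp only [dd, map_mul]; noncomm_ring

theorem dd_comm (g h : G) : dd ⁅g, h⁆ =
    (dd g * dd h - dd h * dd g) * MonoidAlgebra.of ℤ G (g⁻¹ * h⁻¹) := by
  have e : MonoidAlgebra.of ℤ G (g * h * g⁻¹ * h⁻¹) =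
    MonoidAlgebra.of ℤ G g * MonoidAlgebra.of ℤ G h * MonoidAlgebra.of ℤ G (g⁻¹ * h⁻¹) := by
    simp only [← map_mul, mul_assoc]
  have e2 : (1 : MonoidAlgebra ℤ G) =
    MonoidAlgebra.of ℤ G h * MonoidAlgebra.of ℤ G g * MonoidAlgebra.of ℤ G (g⁻¹ * h⁻¹) := by
    simp only [← map_mul]
    rw [← map_one (MonoidAlgebra.of ℤ G)]; congr 1; group
  have e3 : dd g * dd h - dd h * dd g = MonoidAlgebra.of ℤ G g * MonoidAlgebra.of ℤ G h
      - MonoidAlgebra.of ℤ G h * MonoidAlgebra.of ℤ G g := by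
    simp only [dd]; noncomm_ring
  rw [e3, sub_mul, ← e2, ← e]; rfl

def dimSub (G : Type) [Group G] (p : ℕ) (hp : 1 ≤ p) : Subgroup G where
  carrier := {g | dd g ∈ augIdeal G ^ p}
  one_mem' := by
    change dd (1 : G) ∈ augIdeal G ^ p
    rw [dd_one]; exact zero_mem _
  mul_mem' := by
    intro a b ha hb
    simp only [Set.mem_ofPred_eq] at *
    rw [dd_mul]
    exact add_mem (add_mem ha hb) (pw_left hp _ hb)
  inv_mem' := by
    intro a ha
    simp only [Set.mem_ofPred_eq] at *
    have : dd a⁻¹ = - (dd a * MonoidAlgebra.of ℤ G a⁻¹) := by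
      simp only [dd, sub_mul, one_mul, ← map_mul, mul_inv_cancel, map_one]; abel
    rw [this]
    exact neg_mem (pw_right hp _ ha)

theorem lcs_le_dim (m : ℕ) : (⊤ : Subgroup G).lowerCentralSeries m ≤
    dimSub G (m + 1) (by omega) := by
  induction m with
  | zero => intro g _; exact dd_pw1 g
  | succ m ih =>
    rw [Subgroup.lowerCentralSeries_succ, Subgroup.commutator_le]
    intro g hg h _
    have h1 : dd g ∈ augIdeal G ^ (m + 1) := ih hg
    have h2 := dd_pw1 h
    change dd ⁅g, h⁆ ∈ augIdeal G ^ (m + 1 + 1)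
    rw [dd_comm]
    refine pw_right (by omega) _ (sub_mem (pw_mul h1 h2) ?_)
    have := pw_mul h2 h1
    rwa [add_comm 1 (m + 1)] at this

theorem of_eq_dd (g : G) : MonoidAlgebra.of ℤ G g = dd g + 1 := by simp [dd]

theorem dd_pow_two (b : G) (i : ℕ) :
    dd (b ^ 2 ^ (i + 1)) = 2 * dd (b ^ 2 ^ i) + dd (b ^ 2 ^ i) * dd (b ^ 2 ^ i) := by
  rw [pow_succ, pow_mul, pow_two (b ^ 2 ^ i), dd_mul]; noncomm_ring

/-- depth lemma -/
theorem depth (b : G) (M n : ℕ) (hb : dd (b ^ 2 ^ M) ∈ augIdeal G ^ (n - 2)) (p : ℕ) :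
    p + 1 ≤ n - 2 → ∀ j, j ≤ M → ∀ e, p + j ≤ e →
      ((2 : ℤ) ^ e) • dd (b ^ 2 ^ (M - j)) ∈ augIdeal G ^ (p + 1) := by
  induction p with
  | zero => intro _ j _ e _; exact Submodule.smul_mem _ _ (dd_pw1 _)
  | succ p ihp =>
    intro hp j
    induction j with
    | zero =>
      intro _ e _
      exact Submodule.smul_mem _ _ (pw_anti (by omega) hp hb)
    | succ j ihj =>
      intro hj e he
      obtain ⟨e, rfl⟩ : ∃ e', e = e' + 1 := ⟨e - 1, by omega⟩
      have h1 := ihj (by omega) e (by omega)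
      have h2 := ihp (by omega) (j + 1) hj e (by omega)
      have h3 := pw_mul h2 (dd_pw1 (b ^ 2 ^ (M - (j + 1))))
      have e1 : M - j = M - (j + 1) + 1 := by omega
      rw [e1, dd_pow_two] at h1
      have := sub_mem h1 h3
      convert this using 1
      rw [smul_mul_assoc, ← smul_sub, add_sub_cancel_right, pow_succ, mul_smul]
      congr 1
      rw [two_smul, two_mul]

theorem dvd_choose_two_pow (C q : ℕ) (hq : 1 ≤ q) (hq2 : q ≤ 2 ^ C) :
    2 ^ (C - (q - 1)) ∣ (2 ^ C).choose q := by
  have h := Nat.factorization_choose_prime_pow Nat.prime_two hq2 (by omega)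
  rw [Nat.Prime.pow_dvd_iff_le_factorization Nat.prime_two (Nat.choose_pos hq2).ne', h]
  have := Nat.factorization_lt (n := q) 2 (by omega)
  omega

theorem dd_pow_expand (a : G) (N : ℕ) :
    dd (a ^ N) = ∑ q ∈ Finset.range N, ((N.choose (q + 1) : ℕ) : ℤ) • dd a ^ (q + 1) := by
  rw [dd, map_pow, of_eq_dd, (Commute.one_right (dd a)).add_pow, Finset.sum_range_succ']
  simp only [one_pow, mul_one, pow_zero, Nat.choose_zero_right, Nat.cast_one, add_sub_cancel_right]
  refine Finset.sum_congr rfl fun q _ => ?_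
  rw [← (Nat.cast_commute _ _).eq, natCast_zsmul, nsmul_eq_mul]

theorem choose_term_mem (b : G) (M n C q : ℕ) (hn : 4 ≤ n) (hC : M + n ≤ C)
    (hb : dd (b ^ 2 ^ M) ∈ augIdeal G ^ (n - 2)) (hq : 2 ≤ q) (hq2 : q ≤ 2 ^ C) (hqn : q < n) :
    (((2 ^ C).choose q : ℕ) : ℤ) • dd b ∈ augIdeal G ^ (n - q) := by
  obtain ⟨κ, hκ⟩ := dvd_choose_two_pow C q (by omega) hq2
  have h := depth b M n hb (n - q - 1) (by omega) M le_rfl (C - (q - 1)) (by omega)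
  rw [hκ]
  push_cast
  rw [mul_comm, mul_smul]
  refine Submodule.smul_mem _ _ ?_
  have e : n - q - 1 + 1 = n - q := by omega
  rw [e] at h
  simpa using h

theorem dd_pow_mem (a : G) (q : ℕ) : dd a ^ q ∈ augIdeal G ^ q := Submodule.pow_mem_pow _ (dd_mem a) q

theorem mainE (a b : G) (M n C : ℕ) (hn : 4 ≤ n) (hC : M + n ≤ C)
    (hb : dd (b ^ 2 ^ M) ∈ augIdeal G ^ (n - 2)) :
    dd (a ^ 2 ^ C) * dd b - ((2 : ℤ) ^ C) • (dd a * dd b) ∈ augIdeal G ^ n := by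
  rw [dd_pow_expand]
  have hN : 2 ^ C = (2 ^ C - 1) + 1 := by have := Nat.one_le_two_pow (n := C); omega
  rw [hN, Finset.sum_range_succ', ← hN]
  simp only [zero_add, Nat.choose_one_right, pow_one, add_mul, Finset.sum_mul, smul_mul_assoc]
  push_cast
  rw [add_sub_cancel_right]
  refine Submodule.sum_mem _ fun q hq => ?_
  rw [Finset.mem_range] at hq
  by_cases h : q + 1 + 1 < n
  · rw [← mul_smul_comm]
    have := pw_mul (dd_pow_mem a (q + 1 + 1)) (choose_term_mem b M n C (q + 1 + 1) hn hC hb (by omega) (by omega) h)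
    rwa [show q + 1 + 1 + (n - (q + 1 + 1)) = n by omega] at this
  · refine Submodule.smul_mem _ _ (pw_anti (by omega) ?_ (pw_mul (dd_pow_mem a (q + 1 + 1)) (dd_pw1 b)))
    omega

theorem mainE' (a b : G) (M n C : ℕ) (hn : 4 ≤ n) (hC : M + n ≤ C)
    (hb : dd (b ^ 2 ^ M) ∈ augIdeal G ^ (n - 2)) :
    dd b * dd (a ^ 2 ^ C) - ((2 : ℤ) ^ C) • (dd b * dd a) ∈ augIdeal G ^ n := by
  rw [dd_pow_expand]
  have hN : 2 ^ C = (2 ^ C - 1) + 1 := by have := Nat.one_le_two_pow (n := C); omega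
  rw [hN, Finset.sum_range_succ', ← hN]
  simp only [zero_add, Nat.choose_one_right, pow_one, mul_add, Finset.mul_sum, mul_smul_comm]
  push_cast
  rw [add_sub_cancel_right]
  refine Submodule.sum_mem _ fun q hq => ?_
  rw [Finset.mem_range] at hq
  by_cases h : q + 1 + 1 < n
  · rw [← smul_mul_assoc]
    have := pw_mul (choose_term_mem b M n C (q + 1 + 1) hn hC hb (by omega) (by omega) h) (dd_pow_mem a (q + 1 + 1))
    rwa [show (n - (q + 1 + 1)) + (q + 1 + 1) = n by omega] at this
  · refine Submodule.smul_mem _ _ (pw_anti (by omega) ?_ (pw_mul (dd_pw1 b) (dd_pow_mem a (q + 1 + 1))))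
    omega

theorem dd_pow_lin (a : G) (m : ℕ) : dd (a ^ m) - (m : ℤ) • dd a ∈ augIdeal G ^ 2 := by
  induction m with
  | zero => simp [dd_one]
  | succ m ih =>
    rw [pow_succ a m, dd_mul]
    have := pw_mul (dd_pw1 (a ^ m)) (dd_pw1 a)
    convert add_mem ih this using 1
    push_cast
    rw [add_smul, one_smul]; abel

/-- the additive map `g ↦ (g-1)(a-1)` -/
noncomputable def LL (n : ℕ) (hn : 4 ≤ n) (a : G) :
    Additive (dimSub G (n - 2) (by omega)) →+ (MonoidAlgebra ℤ G ⧸ (augIdeal G ^ n)) :=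
  AddMonoidHom.mk' (fun g => Submodule.Quotient.mk (dd (g.toMul : G) * dd a)) (by
    intro g h
    rw [← Submodule.Quotient.mk_add, Submodule.Quotient.eq]
    have h1 : dd (g.toMul : G) ∈ augIdeal G ^ (n - 2) := g.toMul.2
    have h2 : dd (h.toMul : G) ∈ augIdeal G ^ (n - 2) := h.toMul.2
    have h3 := pw_mul (pw_mul h1 h2) (dd_pw1 a)
    rw [toMul_add, Subgroup.coe_mul, dd_mul]
    refine pw_anti (by omega) (?_ : n ≤ n - 2 + (n - 2) + 1) ?_
    · omega
    · convert h3 using 1; noncomm_ring)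

noncomputable def RR (n : ℕ) (hn : 4 ≤ n) (a : G) :
    Additive (dimSub G (n - 2) (by omega)) →+ (MonoidAlgebra ℤ G ⧸ (augIdeal G ^ n)) :=
  AddMonoidHom.mk' (fun g => Submodule.Quotient.mk (dd a * dd (g.toMul : G))) (by
    intro g h
    rw [← Submodule.Quotient.mk_add, Submodule.Quotient.eq]
    have h1 : dd (g.toMul : G) ∈ augIdeal G ^ (n - 2) := g.toMul.2
    have h2 : dd (h.toMul : G) ∈ augIdeal G ^ (n - 2) := h.toMul.2
    have h3 := pw_mul (pw_mul (dd_pw1 a) h1) h2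
    rw [toMul_add, Subgroup.coe_mul, dd_mul]
    refine pw_anti (by omega) (?_ : n ≤ 1 + (n - 2) + (n - 2)) ?_
    · omega
    · convert h3 using 1; noncomm_ring)

theorem LL_kill (n : ℕ) (hn : 4 ≤ n) (a : G) (m : ℕ) (ha : dd (a ^ m) ∈ augIdeal G ^ (n - 2))
    (g : Additive (dimSub G (n - 2) (by omega))) : (m : ℤ) • LL n hn a g = 0 := by
  change (m : ℤ) • Submodule.Quotient.mk (dd (g.toMul : G) * dd a) = _
  rw [← Submodule.Quotient.mk_smul, Submodule.Quotient.mk_eq_zero, ← mul_smul_comm]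
  have h1 : dd (g.toMul : G) ∈ augIdeal G ^ (n - 2) := g.toMul.2
  have h2 := sub_mem (pw_anti (p := 2) (by omega) (by omega) ha) (dd_pow_lin a m)
  rw [sub_sub_cancel] at h2
  have := pw_mul h1 h2
  rwa [show n - 2 + 2 = n by omega] at this

theorem RR_kill (n : ℕ) (hn : 4 ≤ n) (a : G) (m : ℕ) (ha : dd (a ^ m) ∈ augIdeal G ^ (n - 2))
    (g : Additive (dimSub G (n - 2) (by omega))) : (m : ℤ) • RR n hn a g = 0 := by
  change (m : ℤ) • Submodule.Quotient.mk (dd a * dd (g.toMul : G)) = _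
  rw [← Submodule.Quotient.mk_smul, Submodule.Quotient.mk_eq_zero, ← smul_mul_assoc]
  have h1 : dd (g.toMul : G) ∈ augIdeal G ^ (n - 2) := g.toMul.2
  have h2 := sub_mem (pw_anti (p := 2) (by omega) (by omega) ha) (dd_pow_lin a m)
  rw [sub_sub_cancel] at h2
  have := pw_mul h2 h1
  rwa [show 2 + (n - 2) = n by omega] at this

theorem LL_zsmul (n : ℕ) (hn : 4 ≤ n) (a y : G) (hy : y ∈ dimSub G (n - 2) (by omega)) (m : ℕ) :
    (m : ℤ) • LL n hn a (Additive.ofMul ⟨y, hy⟩) = Submodule.Quotient.mk (dd (y ^ m) * dd a) := by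
  rw [← map_zsmul (LL n hn a), natCast_zsmul, ← ofMul_pow]
  rfl

theorem RR_zsmul (n : ℕ) (hn : 4 ≤ n) (a y : G) (hy : y ∈ dimSub G (n - 2) (by omega)) (m : ℕ) :
    (m : ℤ) • RR n hn a (Additive.ofMul ⟨y, hy⟩) = Submodule.Quotient.mk (dd a * dd (y ^ m)) := by
  rw [← map_zsmul (RR n hn a), natCast_zsmul, ← ofMul_pow]
  rfl

/-- the exchange relation -/
theorem exchange (n : ℕ) (hn : 4 ≤ n) (a b : G) (Ma Mb C ca cb : ℕ)
    (ha : a ^ 2 ^ Ma ∈ dimSub G (n - 2) (by omega)) (hb : b ^ 2 ^ Mb ∈ dimSub G (n - 2) (by omega))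
    (h1 : Ma + n ≤ C) (h2 : Mb + n ≤ C) (hca : 2 ^ C = 2 ^ Ma * ca) (hcb : 2 ^ C = 2 ^ Mb * cb) :
    (ca : ℤ) • LL n hn b (Additive.ofMul ⟨_, ha⟩) = (cb : ℤ) • RR n hn a (Additive.ofMul ⟨_, hb⟩) := by
  rw [LL_zsmul, RR_zsmul, ← pow_mul, ← pow_mul, ← hca, ← hcb, Submodule.Quotient.eq]
  have := sub_mem (mainE a b Mb n C hn h2 hb) (mainE' b a Ma n C hn h1 ha)
  rwa [sub_sub_sub_cancel_right] at this

theorem part_one (n : ℕ) (hn : 4 ≤ n) (τ H : ℕ) (hτ : n ≤ τ) (hH : H = 2 ^ τ)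
    (a1 a2 a3 y1 y2 y3 : G)
    (hy1 : y1 ∈ gammaGrp G (n - 2)) (hy2 : y2 ∈ gammaGrp G (n - 2)) (hy3 : y3 ∈ gammaGrp G (n - 2))
    (r1 : a1 ^ (4 * H) = y2 * y3 ^ 2)
    (r2 : a2 ^ (16 * H ^ 2) = y1⁻¹ * y3 ^ (4 * H))
    (r3 : a3 ^ (64 * H ^ 3) = (y1 ^ 2)⁻¹ * (y2 ^ (4 * H))⁻¹)
    (o1 : y1 ^ (4 * H) = 1) (o2 : y2 ^ (16 * H ^ 2) = 1) :
    ⁅y2 ^ (8 * H ^ 2), a2⁆ ∈ dimensionSubgroup G n := by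
  have hle : gammaGrp G (n - 2) ≤ dimSub G (n - 2) (by omega) := by
    have := lcs_le_dim (G := G) (n - 2 - 1)
    unfold gammaGrp
    convert this using 2
    omega
  replace hy1 := hle hy1
  replace hy2 := hle hy2
  replace hy3 := hle hy3
  have m1 : 4 * H = 2 ^ (τ + 2) := by rw [hH, pow_add]; ring
  have m2 : 16 * H ^ 2 = 2 ^ (2 * τ + 4) := by rw [hH, pow_add, pow_mul']; ring
  have m3 : 64 * H ^ 3 = 2 ^ (3 * τ + 6) := by rw [hH, pow_add, pow_mul']; ring
  have k1 : a1 ^ 2 ^ (τ + 2) ∈ dimSub G (n - 2) (by omega) := by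
    rw [← m1, r1]; exact mul_mem hy2 (pow_mem hy3 _)
  have k2 : a2 ^ 2 ^ (2 * τ + 4) ∈ dimSub G (n - 2) (by omega) := by
    rw [← m2, r2]; exact mul_mem (inv_mem hy1) (pow_mem hy3 _)
  have k3 : a3 ^ 2 ^ (3 * τ + 6) ∈ dimSub G (n - 2) (by omega) := by
    rw [← m3, r3]; exact mul_mem (inv_mem (pow_mem hy1 _)) (inv_mem (pow_mem hy2 _))
  set Y1 : Additive (dimSub G (n - 2) (by omega)) := Additive.ofMul ⟨y1, hy1⟩ with hY1
  set Y2 : Additive (dimSub G (n - 2) (by omega)) := Additive.ofMul ⟨y2, hy2⟩ with hY2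
  set Y3 : Additive (dimSub G (n - 2) (by omega)) := Additive.ofMul ⟨y3, hy3⟩ with hY3
  have E1 : (Additive.ofMul ⟨_, k1⟩ : Additive (dimSub G (n - 2) (by omega))) = Y2 + (2 : ℤ) • Y3 := by
    apply Additive.toMul.injective; apply Subtype.ext
    change a1 ^ 2 ^ (τ + 2) = y2 * y3 ^ (2 : ℤ)
    rw [← m1, r1]; norm_cast
  have E2 : (Additive.ofMul ⟨_, k2⟩ : Additive (dimSub G (n - 2) (by omega))) =
      -Y1 + ((4 * H : ℕ) : ℤ) • Y3 := by
    apply Additive.toMul.injective; apply Subtype.ext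
    change a2 ^ 2 ^ (2 * τ + 4) = y1⁻¹ * y3 ^ ((4 * H : ℕ) : ℤ)
    rw [← m2, r2, zpow_natCast]
  have E3 : (Additive.ofMul ⟨_, k3⟩ : Additive (dimSub G (n - 2) (by omega))) =
      -((2 : ℤ) • Y1) + -(((4 * H : ℕ) : ℤ) • Y2) := by
    apply Additive.toMul.injective; apply Subtype.ext
    change a3 ^ 2 ^ (3 * τ + 6) = (y1 ^ (2 : ℤ))⁻¹ * (y2 ^ ((4 * H : ℕ) : ℤ))⁻¹
    rw [← m3, r3, zpow_natCast]; norm_cast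
  have O1 : ((4 * H : ℕ) : ℤ) • Y1 = 0 := by
    apply Additive.toMul.injective; apply Subtype.ext
    change y1 ^ ((4 * H : ℕ) : ℤ) = 1
    rw [zpow_natCast, o1]
  have O2 : ((16 * H ^ 2 : ℕ) : ℤ) • Y2 = 0 := by
    apply Additive.toMul.injective; apply Subtype.ext
    change y2 ^ ((16 * H ^ 2 : ℕ) : ℤ) = 1
    rw [zpow_natCast, o2]
  have X12 := exchange n hn a1 a2 (τ + 2) (2 * τ + 4) (3 * τ + 5) (8 * H ^ 2) (2 * H) k1 k2
    (by omega) (by omega) (by rw [hH]; ring) (by rw [hH]; ring)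
  have X13 := exchange n hn a1 a3 (τ + 2) (3 * τ + 6) (4 * τ + 6) (16 * H ^ 3) H k1 k3
    (by omega) (by omega) (by rw [hH]; ring) (by rw [hH]; ring)
  have X23 := exchange n hn a2 a3 (2 * τ + 4) (3 * τ + 6) (4 * τ + 7) (8 * H ^ 2) (2 * H) k2 k3
    (by omega) (by omega) (by rw [hH]; ring) (by rw [hH]; ring)
  have z1 := LL_kill n hn a2 (16 * H ^ 2) (by rw [m2]; exact k2) Y3
  have z2 := RR_kill n hn a1 (4 * H) (by rw [m1]; exact k1) Y3
  have z3 := RR_kill n hn a1 (4 * H) (by rw [m1]; exact k1) Y2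
  have z4 : ((16 * H ^ 2 : ℕ) : ℤ) • LL n hn a3 Y2 = 0 := by rw [← map_zsmul (LL n hn a3), O2, map_zero]
  have z5 : ((4 * H : ℕ) : ℤ) • LL n hn a3 Y1 = 0 := by rw [← map_zsmul (LL n hn a3), O1, map_zero]
  have z6 : ((4 * H : ℕ) : ℤ) • RR n hn a2 Y1 = 0 := by rw [← map_zsmul (RR n hn a2), O1, map_zero]
  have z7 := RR_kill n hn a2 (16 * H ^ 2) (by rw [m2]; exact k2) Y2
  rw [E1, E2] at X12
  rw [E1, E3] at X13
  rw [E2, E3] at X23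
  simp only [map_add, map_neg, map_zsmul] at X12 X13 X23
  have key : ((8 * H ^ 2 : ℕ) : ℤ) • LL n hn a2 Y2 = ((8 * H ^ 2 : ℕ) : ℤ) • RR n hn a2 Y2 := by
    push_cast at *
    linear_combination (norm := module) X12 - X13 + X23 - z1 + (2 * (H : ℤ)) • z2 + (H : ℤ) • z3
      + (H : ℤ) • z4 + (2 * (H : ℤ)) • z5 - z6 - z7
  rw [hY2, LL_zsmul, RR_zsmul, Submodule.Quotient.eq] at key
  change dd _ ∈ augIdeal G ^ n
  rw [dd_comm]
  exact pw_right (by omega) _ key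

end PartOne

section PartTwo
open scoped commutatorElement

@[ext]
structure Gam (S : Type) [CommRing S] (t : S) (k : ℕ) (h : ℤ) where
  f1 : S
  f2 : S
  f3 : S
  g : S
  x1 : ℤ
  x2 : ℤ
  x3 : ℤ
  u : Sˣ
  hu : t ∣ (u : S) - 1
  hk : (u : S) * t ^ k = t ^ k

namespace Gam
variable {S : Type} [CommRing S] {t : S} {k : ℕ} {h : ℤ}

def om (h : ℤ) (x1 x2 y2 y3 : ℤ) : ℤ := -(h ^ 2 * x1 * y2 + 2 * h * x1 * y3 + h * x2 * y3)

instance : Mul (Gam S t k h) where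
  mul a b :=
    { f1 := a.f1 + a.u * b.f1
      f2 := a.f2 + a.u * b.f2
      f3 := a.f3 + a.u * b.f3
      g := a.g + a.u * b.g + ((a.x1 : S) * h ^ 4 * a.u * b.f1 + (a.x2 : S) * h ^ 3 * a.u * b.f2
        + (a.x3 : S) * h ^ 2 * a.u * b.f3) + (om h a.x1 a.x2 b.x2 b.x3 : ℤ) * t ^ k
      x1 := a.x1 + b.x1
      x2 := a.x2 + b.x2
      x3 := a.x3 + b.x3
      u := a.u * b.u
      hu := by
        obtain ⟨p, hp⟩ := a.hu
        obtain ⟨q, hq⟩ := b.hu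
        refine ⟨p * b.u + q, ?_⟩
        rw [Units.val_mul]
        linear_combination (b.u : S) * hp + hq
      hk := by rw [Units.val_mul, mul_assoc, b.hk, a.hk] }

instance : One (Gam S t k h) where
  one := { f1 := 0, f2 := 0, f3 := 0, g := 0, x1 := 0, x2 := 0, x3 := 0, u := 1, hu := by simp, hk := by simp }

instance : Inv (Gam S t k h) where
  inv a :=
    { f1 := -((a.u⁻¹ : Sˣ) : S) * a.f1
      f2 := -((a.u⁻¹ : Sˣ) : S) * a.f2
      f3 := -((a.u⁻¹ : Sˣ) : S) * a.f3
      g := -((a.u⁻¹ : Sˣ) : S) * a.g + ((a.x1 : S) * h ^ 4 * (a.u⁻¹ : Sˣ) * a.f1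
        + (a.x2 : S) * h ^ 3 * (a.u⁻¹ : Sˣ) * a.f2
        + (a.x3 : S) * h ^ 2 * (a.u⁻¹ : Sˣ) * a.f3) + (om h a.x1 a.x2 a.x2 a.x3 : ℤ) * t ^ k
      x1 := -a.x1
      x2 := -a.x2
      x3 := -a.x3
      u := a.u⁻¹
      hu := by
        obtain ⟨p, hp⟩ := a.hu
        refine ⟨-p * (a.u⁻¹ : Sˣ), ?_⟩
        linear_combination (-((a.u⁻¹ : Sˣ) : S)) * hp + a.u.inv_mul
      hk := by
        have := congrArg (fun z => ((a.u⁻¹ : Sˣ) : S) * z) a.hk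
        simpa using this.symm }

theorem mul_f1 (a b : Gam S t k h) : (a * b).f1 = a.f1 + a.u * b.f1 := rfl
theorem mul_f2 (a b : Gam S t k h) : (a * b).f2 = a.f2 + a.u * b.f2 := rfl
theorem mul_f3 (a b : Gam S t k h) : (a * b).f3 = a.f3 + a.u * b.f3 := rfl
theorem mul_g (a b : Gam S t k h) : (a * b).g =
  a.g + a.u * b.g + ((a.x1 : S) * h ^ 4 * a.u * b.f1 + (a.x2 : S) * h ^ 3 * a.u * b.f2
        + (a.x3 : S) * h ^ 2 * a.u * b.f3) + (om h a.x1 a.x2 b.x2 b.x3 : ℤ) * t ^ k := rfl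
theorem mul_x1 (a b : Gam S t k h) : (a * b).x1 = a.x1 + b.x1 := rfl
theorem mul_x2 (a b : Gam S t k h) : (a * b).x2 = a.x2 + b.x2 := rfl
theorem mul_x3 (a b : Gam S t k h) : (a * b).x3 = a.x3 + b.x3 := rfl
theorem mul_u (a b : Gam S t k h) : (a * b).u = a.u * b.u := rfl
theorem one_f1 : (1 : Gam S t k h).f1 = 0 := rfl
theorem one_f2 : (1 : Gam S t k h).f2 = 0 := rfl
theorem one_f3 : (1 : Gam S t k h).f3 = 0 := rfl
theorem one_g : (1 : Gam S t k h).g = 0 := rfl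
theorem one_x1 : (1 : Gam S t k h).x1 = 0 := rfl
theorem one_x2 : (1 : Gam S t k h).x2 = 0 := rfl
theorem one_x3 : (1 : Gam S t k h).x3 = 0 := rfl
theorem one_u : (1 : Gam S t k h).u = 1 := rfl
theorem inv_f1 (a : Gam S t k h) : (a⁻¹).f1 = -((a.u⁻¹ : Sˣ) : S) * a.f1 := rfl
theorem inv_f2 (a : Gam S t k h) : (a⁻¹).f2 = -((a.u⁻¹ : Sˣ) : S) * a.f2 := rfl
theorem inv_f3 (a : Gam S t k h) : (a⁻¹).f3 = -((a.u⁻¹ : Sˣ) : S) * a.f3 := rfl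
theorem inv_g (a : Gam S t k h) : (a⁻¹).g = -((a.u⁻¹ : Sˣ) : S) * a.g + ((a.x1 : S) * h ^ 4 * (a.u⁻¹ : Sˣ) * a.f1
        + (a.x2 : S) * h ^ 3 * (a.u⁻¹ : Sˣ) * a.f2
        + (a.x3 : S) * h ^ 2 * (a.u⁻¹ : Sˣ) * a.f3) + (om h a.x1 a.x2 a.x2 a.x3 : ℤ) * t ^ k := rfl
theorem inv_x1 (a : Gam S t k h) : (a⁻¹).x1 = -a.x1 := rfl
theorem inv_x2 (a : Gam S t k h) : (a⁻¹).x2 = -a.x2 := rfl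
theorem inv_x3 (a : Gam S t k h) : (a⁻¹).x3 = -a.x3 := rfl
theorem inv_u (a : Gam S t k h) : (a⁻¹).u = (a.u)⁻¹ := rfl

instance : Group (Gam S t k h) := Group.ofLeftAxioms
  (by
    intro a b c
    ext
    · simp only [mul_f1, mul_u, Units.val_mul]; ring
    · simp only [mul_f2, mul_u, Units.val_mul]; ring
    · simp only [mul_f3, mul_u, Units.val_mul]; ring
    · simp only [mul_f1, mul_f2, mul_f3, mul_g, mul_x1, mul_x2, mul_x3, mul_u, Units.val_mul, om]
      push_cast
      linear_combination ((h : S) ^ 2 * b.x1 * c.x2 + 2 * h * b.x1 * c.x3 + h * b.x2 * c.x3) * a.hk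
    · simp only [mul_x1]; ring
    · simp only [mul_x2]; ring
    · simp only [mul_x3]; ring
    · simp only [mul_u]; rw [mul_assoc])
  (by
    intro a
    ext
    · simp [mul_f1, one_f1, one_u]
    · simp [mul_f2, one_f2, one_u]
    · simp [mul_f3, one_f3, one_u]
    · simp [mul_g, one_g, one_u, one_x1, one_x2, one_x3, om]
    · simp [mul_x1, one_x1]
    · simp [mul_x2, one_x2]
    · simp [mul_x3, one_x3]
    · simp [mul_u, one_u])
  (by
    intro a
    ext
    · simp [mul_f1, one_f1, inv_f1, inv_u]
    · simp [mul_f2, one_f2, inv_f2, inv_u]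
    · simp [mul_f3, one_f3, inv_f3, inv_u]
    · simp only [mul_g, one_g, inv_g, inv_u, inv_x1, inv_x2, inv_x3, om]
      push_cast
      ring
    · simp [mul_x1, one_x1, inv_x1]
    · simp [mul_x2, one_x2, inv_x2]
    · simp [mul_x3, one_x3, inv_x3]
    · simp [mul_u, one_u, inv_u])

/-- the relation subgroup -/
def KK (S : Type) [CommRing S] (t : S) (k : ℕ) (h : ℤ) : Subgroup (Gam S t k h) where
  carrier := {c | c.u = 1 ∧ ∃ (α1 α2 α3 : ℤ) (p1 p2 p3 q : S),
    c.x1 = h * α1 ∧ c.x2 = h ^ 2 * α2 ∧ c.x3 = h ^ 3 * α3 ∧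
    c.f1 = (α2 + 2 * α3) * t ^ k + h * p1 ∧ c.f2 = (-α1 + h * α3) * t ^ k + h ^ 2 * p2 ∧
    c.f3 = (-2 * α1 - h * α2) * t ^ k + h ^ 3 * p3 ∧ c.g = h ^ 5 * q}
  one_mem' := by
    refine ⟨rfl, 0, 0, 0, 0, 0, 0, 0, ?_⟩
    simp [one_f1, one_f2, one_f3, one_g, one_x1, one_x2, one_x3]
  mul_mem' := by
    rintro c d ⟨hu, α1, α2, α3, p1, p2, p3, q, hx1, hx2, hx3, hf1, hf2, hf3, hg⟩
      ⟨hu', α1', α2', α3', p1', p2', p3', q', hx1', hx2', hx3', hf1', hf2', hf3', hg'⟩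
    refine ⟨by rw [mul_u, hu, hu', one_mul], α1 + α1', α2 + α2', α3 + α3', p1 + p1', p2 + p2', p3 + p3',
      q + q' + (α1 * d.f1 + α2 * d.f2 + α3 * d.f3) - (α1 * α2' + 2 * α1 * α3' + h * α2 * α3') * t ^ k,
      ?_, ?_, ?_, ?_, ?_, ?_, ?_⟩
    · rw [mul_x1, hx1, hx1']; ring
    · rw [mul_x2, hx2, hx2']; ring
    · rw [mul_x3, hx3, hx3']; ring
    · rw [mul_f1, hf1, hf1', hu]; push_cast; ring
    · rw [mul_f2, hf2, hf2', hu]; push_cast; ring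
    · rw [mul_f3, hf3, hf3', hu]; push_cast; ring
    · rw [mul_g, hg, hg', hu, hx1, hx2, hx3, hx2', hx3', om]; push_cast; ring
  inv_mem' := by
    rintro c ⟨hu, α1, α2, α3, p1, p2, p3, q, hx1, hx2, hx3, hf1, hf2, hf3, hg⟩
    refine ⟨by rw [inv_u, hu, inv_one], -α1, -α2, -α3, -p1, -p2, -p3,
      -q + (α1 * c.f1 + α2 * c.f2 + α3 * c.f3) - (α1 * α2 + 2 * α1 * α3 + h * α2 * α3) * t ^ k,
      ?_, ?_, ?_, ?_, ?_, ?_, ?_⟩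
    · rw [inv_x1, hx1]; ring
    · rw [inv_x2, hx2]; ring
    · rw [inv_x3, hx3]; ring
    · rw [inv_f1, hf1, hu]; push_cast; simp; ring
    · rw [inv_f2, hf2, hu]; push_cast; simp; ring
    · rw [inv_f3, hf3, hu]; push_cast; simp; ring
    · rw [inv_g, hg, hu, hx1, hx2, hx3, om, inv_one]; push_cast; ring

instance KK_normal : (KK S t k h).Normal := by
  constructor
  rintro c ⟨hu, α1, α2, α3, p1, p2, p3, q, hx1, hx2, hx3, hf1, hf2, hf3, hg⟩ d
  have E : (d * c * d⁻¹) * d = d * c := by group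
  generalize d * c * d⁻¹ = e at E
  have eu := congrArg Gam.u E
  have ef1 := congrArg Gam.f1 E
  have ef2 := congrArg Gam.f2 E
  have ef3 := congrArg Gam.f3 E
  have eg := congrArg Gam.g E
  have ex1 := congrArg Gam.x1 E
  have ex2 := congrArg Gam.x2 E
  have ex3 := congrArg Gam.x3 E
  rw [mul_u, mul_u, hu, mul_one, mul_eq_right] at eu
  simp only [mul_f1, mul_f2, mul_f3, mul_g, mul_x1, mul_x2, mul_x3, eu, om] at ef1 ef2 ef3 eg ex1 ex2 ex3
  have ex1' : e.x1 = c.x1 := by linarith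
  have ex2' : e.x2 = c.x2 := by linarith
  have ex3' : e.x3 = c.x3 := by linarith
  have hk := d.hk
  refine ⟨eu, α1, α2, α3, d.u * p1, d.u * p2, d.u * p3,
    d.u * q + d.u * (d.x1 * p1 + d.x2 * p2 + d.x3 * p3) - (α1 * d.f1 + α2 * d.f2 + α3 * d.f3),
    ex1'.trans hx1, ex2'.trans hx2, ex3'.trans hx3, ?_, ?_, ?_, ?_⟩
  · rw [hf1] at ef1; push_cast at ef1; linear_combination ef1 + (α2 + 2 * α3 : S) * hk
  · rw [hf2] at ef2; push_cast at ef2; linear_combination ef2 + (-α1 + h * α3 : S) * hk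
  · rw [hf3] at ef3; push_cast at ef3; linear_combination ef3 + (-2 * α1 - h * α2 : S) * hk
  · rw [hf1, hf2, hf3, hg, ex1', ex2', ex3', hx1, hx2, hx3] at eg
    push_cast at eg
    linear_combination eg + ((d.x1 : S) * h ^ 4 * (α2 + 2 * α3) + d.x2 * h ^ 3 * (-α1 + h * α3)
      + d.x3 * h ^ 2 * (-2 * α1 - h * α2)) * hk

def EE (t : S) (k : ℕ) (h : ℤ) (f1 f2 f3 g : S) (x1 x2 x3 : ℤ) : Gam S t k h :=
  { f1 := f1, f2 := f2, f3 := f3, g := g, x1 := x1, x2 := x2, x3 := x3, u := 1, hu := by simp, hk := by simp }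

theorem EE_mul (f1 f2 f3 g : S) (x1 x2 x3 : ℤ) (f1' f2' f3' g' : S) (x1' x2' x3' : ℤ) :
    EE t k h f1 f2 f3 g x1 x2 x3 * EE t k h f1' f2' f3' g' x1' x2' x3' =
    EE t k h (f1 + f1') (f2 + f2') (f3 + f3') (g + g' + ((x1 : S) * h ^ 4 * f1' + (x2 : S) * h ^ 3 * f2'
        + (x3 : S) * h ^ 2 * f3') + (om h x1 x2 x2' x3' : ℤ) * t ^ k) (x1 + x1') (x2 + x2') (x3 + x3') := by
  ext <;> simp [EE, mul_f1, mul_f2, mul_f3, mul_g, mul_x1, mul_x2, mul_x3, mul_u]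

theorem EE_one : (1 : Gam S t k h) = EE t k h 0 0 0 0 0 0 0 := rfl

theorem EE_inv (f1 f2 f3 g : S) (x1 x2 x3 : ℤ) :
    (EE t k h f1 f2 f3 g x1 x2 x3)⁻¹ =
    EE t k h (-f1) (-f2) (-f3) (-g + ((x1 : S) * h ^ 4 * f1 + (x2 : S) * h ^ 3 * f2
        + (x3 : S) * h ^ 2 * f3) + (om h x1 x2 x2 x3 : ℤ) * t ^ k) (-x1) (-x2) (-x3) := by
  ext <;> simp [EE, inv_f1, inv_f2, inv_f3, inv_g, inv_x1, inv_x2, inv_x3, inv_u]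

theorem F_pow (f1 f2 f3 g : S) (m : ℕ) : (EE t k h f1 f2 f3 g 0 0 0) ^ m =
    EE t k h (m * f1) (m * f2) (m * f3) (m * g) 0 0 0 := by
  induction m with
  | zero => rw [pow_zero, EE_one]; simp
  | succ m ih => rw [pow_succ, ih, EE_mul]; simp [om]; congr 1 <;> ring

theorem A1_pow (m : ℕ) : (EE t k h 0 0 0 0 1 0 0) ^ m = EE t k h 0 0 0 0 m 0 0 := by
  induction m with
  | zero => rw [pow_zero, EE_one]; simp
  | succ m ih => rw [pow_succ, ih, EE_mul]; simp [om]

theorem A2_pow (m : ℕ) : (EE t k h 0 0 0 0 0 1 0) ^ m = EE t k h 0 0 0 0 0 m 0 := by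
  induction m with
  | zero => rw [pow_zero, EE_one]; simp
  | succ m ih => rw [pow_succ, ih, EE_mul]; simp [om]

theorem A3_pow (m : ℕ) : (EE t k h 0 0 0 0 0 0 1) ^ m = EE t k h 0 0 0 0 0 0 m := by
  induction m with
  | zero => rw [pow_zero, EE_one]; simp
  | succ m ih => rw [pow_succ, ih, EE_mul]; simp [om]

theorem comm_w (m : ℕ) : ⁅(EE t k h 0 (t ^ k) 0 0 0 0 0) ^ m, EE t k h 0 0 0 0 0 1 0⁆ =
    EE t k h 0 0 0 (-(h ^ 3 * m * t ^ k)) 0 0 0 := by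
  rw [F_pow, commutatorElement_def, mul_inv_eq_iff_eq_mul, mul_inv_eq_iff_eq_mul, EE_mul, EE_mul, EE_mul]
  simp [om]
  congr 1; ring

theorem t_mem (ht : t ^ (k + 1) = 0) (f1 f2 f3 : S) (m : ℕ) :
    EE t k h (t ^ m * f1) (t ^ m * f2) (t ^ m * f3) 0 0 0 0 ∈
      (⊤ : Subgroup (Gam S t k h)).lowerCentralSeries m := by
  induction m with
  | zero => exact Subgroup.mem_top _
  | succ m ih =>
    have hun : IsUnit (1 - t) := IsNilpotent.isUnit_one_sub ⟨k + 1, ht⟩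
    let r : Gam S t k h :=
      { f1 := 0, f2 := 0, f3 := 0, g := 0, x1 := 0, x2 := 0, x3 := 0, u := hun.unit
        hu := ⟨-1, by rw [IsUnit.unit_spec]; ring⟩
        hk := by rw [IsUnit.unit_spec]; linear_combination -ht }
    have : EE t k h (t ^ (m + 1) * f1) (t ^ (m + 1) * f2) (t ^ (m + 1) * f3) 0 0 0 0 =
        ⁅EE t k h (t ^ m * f1) (t ^ m * f2) (t ^ m * f3) 0 0 0 0, r⁆ := by
      rw [commutatorElement_def, eq_mul_inv_iff_mul_eq, eq_mul_inv_iff_mul_eq]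
      ext
      · simp [EE, r, mul_f1, mul_u]; ring
      · simp [EE, r, mul_f2, mul_u]; ring
      · simp [EE, r, mul_f3, mul_u]; ring
      · simp [EE, r, mul_g, mul_x1, mul_x2, mul_x3, mul_u, om]
      · simp [EE, r, mul_x1]
      · simp [EE, r, mul_x2]
      · simp [EE, r, mul_x3]
      · simp [EE, r, mul_u]
    rw [this, Subgroup.lowerCentralSeries_succ]
    exact Subgroup.commutator_mem_commutator ih (Subgroup.mem_top _)

def FF (S : Type) [CommRing S] (t : S) (k : ℕ) (h : ℤ) (m : ℕ) : Subgroup (Gam S t k h) where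
  carrier := {c | c.u = 1 ∧ c.x1 = 0 ∧ c.x2 = 0 ∧ c.x3 = 0 ∧ t ^ (m + 1) ∣ c.f1 ∧ t ^ (m + 1) ∣ c.f2 ∧
    t ^ (m + 1) ∣ c.f3 ∧ t ^ m ∣ c.g}
  one_mem' := by simp [one_f1, one_f2, one_f3, one_g, one_x1, one_x2, one_x3, one_u]
  mul_mem' := by
    rintro a b ⟨u, x1, x2, x3, f1, f2, f3, g⟩ ⟨u', x1', x2', x3', f1', f2', f3', g'⟩
    refine ⟨by rw [mul_u, u, u', one_mul], by rw [mul_x1, x1, x1', add_zero], by rw [mul_x2, x2, x2', add_zero],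
      by rw [mul_x3, x3, x3', add_zero], ?_, ?_, ?_, ?_⟩
    · rw [mul_f1]; exact dvd_add f1 (f1'.mul_left _)
    · rw [mul_f2]; exact dvd_add f2 (f2'.mul_left _)
    · rw [mul_f3]; exact dvd_add f3 (f3'.mul_left _)
    · rw [mul_g, x1, x2, x3, om]; simpa using dvd_add g (g'.mul_left _)
  inv_mem' := by
    rintro a ⟨u, x1, x2, x3, f1, f2, f3, g⟩
    refine ⟨by rw [inv_u, u, inv_one], by rw [inv_x1, x1, neg_zero], by rw [inv_x2, x2, neg_zero],
      by rw [inv_x3, x3, neg_zero], ?_, ?_, ?_, ?_⟩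
    · rw [inv_f1]; exact f1.mul_left _
    · rw [inv_f2]; exact f2.mul_left _
    · rw [inv_f3]; exact f3.mul_left _
    · rw [inv_g, x1, x2, x3, om]; simpa using g

theorem lcs_le_FF (m : ℕ) : (⊤ : Subgroup (Gam S t k h)).lowerCentralSeries (m + 1) ≤ FF S t k h m := by
  induction m with
  | zero =>
    rw [Subgroup.lowerCentralSeries_succ, Subgroup.commutator_le]
    intro a _ b _
    have E : ⁅a, b⁆ * (b * a) = a * b := by rw [commutatorElement_def]; group
    generalize ⁅a, b⁆ = e at E
    have eu := congrArg Gam.u E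
    have ef1 := congrArg Gam.f1 E
    have ef2 := congrArg Gam.f2 E
    have ef3 := congrArg Gam.f3 E
    have ex1 := congrArg Gam.x1 E
    have ex2 := congrArg Gam.x2 E
    have ex3 := congrArg Gam.x3 E
    rw [mul_u, mul_u, mul_u, mul_comm a.u, mul_eq_right] at eu
    simp only [mul_f1, mul_f2, mul_f3, mul_x1, mul_x2, mul_x3, eu] at ef1 ef2 ef3 ex1 ex2 ex3
    push_cast at ef1 ef2 ef3
    obtain ⟨p, hp⟩ := a.hu
    obtain ⟨q, hq⟩ := b.hu
    refine ⟨eu, by linarith, by linarith, by linarith, ⟨p * b.f1 - q * a.f1, ?_⟩,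
      ⟨p * b.f2 - q * a.f2, ?_⟩, ⟨p * b.f3 - q * a.f3, ?_⟩, by simp⟩
    · linear_combination ef1 + b.f1 * hp - a.f1 * hq
    · linear_combination ef2 + b.f2 * hp - a.f2 * hq
    · linear_combination ef3 + b.f3 * hp - a.f3 * hq
  | succ m ih =>
    rw [Subgroup.lowerCentralSeries_succ, Subgroup.commutator_le]
    intro a ha b _
    obtain ⟨au, ax1, ax2, ax3, ⟨p1, h1⟩, ⟨p2, h2⟩, ⟨p3, h3⟩, ⟨p4, h4⟩⟩ := ih ha
    have E : ⁅a, b⁆ * (b * a) = a * b := by rw [commutatorElement_def]; group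
    generalize ⁅a, b⁆ = e at E
    have eu := congrArg Gam.u E
    have ef1 := congrArg Gam.f1 E
    have ef2 := congrArg Gam.f2 E
    have ef3 := congrArg Gam.f3 E
    have eg := congrArg Gam.g E
    have ex1 := congrArg Gam.x1 E
    have ex2 := congrArg Gam.x2 E
    have ex3 := congrArg Gam.x3 E
    rw [mul_u, mul_u, mul_u, mul_comm a.u, mul_eq_right] at eu
    simp only [mul_x1, mul_x2, mul_x3] at ex1 ex2 ex3
    have ex1' : e.x1 = 0 := by linarith
    have ex2' : e.x2 = 0 := by linarith
    have ex3' : e.x3 = 0 := by linarith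
    simp only [mul_f1, mul_f2, mul_f3, mul_g, mul_x2, mul_x3, eu, au, ax1, ax2, ax3, h1, h2, h3, h4, ex1', ex2', ex3', om] at ef1 ef2 ef3 eg
    push_cast at ef1 ef2 ef3 eg
    obtain ⟨q, hq⟩ := b.hu
    refine ⟨eu, ex1', ex2', ex3', ⟨-q * p1, ?_⟩, ⟨-q * p2, ?_⟩, ⟨-q * p3, ?_⟩,
      ⟨-q * p4 - b.u * (b.x1 * h ^ 4 * p1 + b.x2 * h ^ 3 * p2 + b.x3 * h ^ 2 * p3), ?_⟩⟩
    · linear_combination ef1 - t ^ (m + 1) * p1 * hq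
    · linear_combination ef2 - t ^ (m + 1) * p2 * hq
    · linear_combination ef3 - t ^ (m + 1) * p3 * hq
    · linear_combination eg - t ^ m * p4 * hq

theorem FF_bot (ht : t ^ (k + 1) = 0) : FF S t k h (k + 1) = ⊥ := by
  rw [eq_bot_iff]
  rintro a ⟨u, x1, x2, x3, f1, f2, f3, g⟩
  rw [pow_succ, ht, zero_mul, zero_dvd_iff] at f1 f2 f3
  rw [ht, zero_dvd_iff] at g
  rw [Subgroup.mem_bot]
  ext <;> first | assumption | (rw [u]; rfl)

end Gam
end PartTwo

section PartThree
open scoped commutatorElement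
open Gam

abbrev SS (k : ℕ) : Type := Polynomial ℤ ⧸ (Ideal.span {(Polynomial.X : Polynomial ℤ) ^ (k + 1)})

noncomputable def tt (k : ℕ) : SS k := Ideal.Quotient.mk _ Polynomial.X

theorem tt_pow (k : ℕ) : tt k ^ (k + 1) = 0 := by
  rw [tt, ← map_pow, Ideal.Quotient.eq_zero_iff_mem]
  exact Ideal.mem_span_singleton_self _

theorem tt_dvd (k : ℕ) (c N : ℤ) (q : SS k) (hq : (c : SS k) * tt k ^ k = (N : SS k) * q) : N ∣ c := by
  obtain ⟨q, rfl⟩ := Ideal.Quotient.mk_surjective q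
  rw [tt, ← map_pow, ← map_intCast (Ideal.Quotient.mk (Ideal.span {(Polynomial.X : Polynomial ℤ) ^ (k + 1)})) c,
    ← map_intCast (Ideal.Quotient.mk (Ideal.span {(Polynomial.X : Polynomial ℤ) ^ (k + 1)})) N,
    ← map_mul, ← map_mul, Ideal.Quotient.eq, Ideal.mem_span_singleton, Polynomial.X_pow_dvd_iff] at hq
  have := hq k (by omega)
  rw [Polynomial.coeff_sub, Polynomial.coeff_intCast_mul, Polynomial.coeff_intCast_mul,
    Polynomial.coeff_X_pow_self] at this
  exact ⟨q.coeff k, by push_cast at this; linarith⟩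

theorem main_thm (n : ℕ) (hn : 4 ≤ n) :
    ∃ (G : Type) (_ : Group G) (g : G),
      g ∈ dimensionSubgroup G n ∧ g ∉ gammaGrp G n ∧ g ^ 2 ∈ gammaGrp G n := by
  obtain ⟨k, rfl⟩ : ∃ k, n = k + 3 := ⟨n - 3, by omega⟩
  obtain ⟨H, hH⟩ : ∃ H : ℕ, H = 2 ^ (k + 3) := ⟨_, rfl⟩
  have hHpos : 0 < H := by rw [hH]; positivity
  obtain ⟨h, hh⟩ : ∃ h : ℤ, h = 4 * H := ⟨_, rfl⟩
  have hpos : 0 < h := by omega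
  obtain ⟨t, htt⟩ : ∃ t : SS k, t = tt k := ⟨_, rfl⟩
  have ht : t ^ (k + 1) = 0 := by rw [htt]; exact tt_pow k
  let π : Gam (SS k) t k h →* Gam (SS k) t k h ⧸ KK (SS k) t k h := QuotientGroup.mk' (KK (SS k) t k h)
  have hπ : Function.Surjective π := QuotientGroup.mk'_surjective (KK (SS k) t k h)
  have hmap : ∀ m, (⊤ : Subgroup (Gam (SS k) t k h ⧸ KK (SS k) t k h)).lowerCentralSeries m =
      ((⊤ : Subgroup (Gam (SS k) t k h)).lowerCentralSeries m).map π := by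
    intro m
    rw [Subgroup.map_lowerCentralSeries, Subgroup.map_top_of_surjective π hπ]
  have hbot : gammaGrp (Gam (SS k) t k h ⧸ KK (SS k) t k h) (k + 3) = ⊥ := by
    unfold gammaGrp
    rw [hmap, eq_bot_iff]
    have h1 := lcs_le_FF (S := SS k) (t := t) (k := k) (h := h) (k + 1)
    rw [FF_bot ht] at h1
    have h2 := Subgroup.map_mono (f := π) h1
    rwa [Subgroup.map_bot] at h2
  have hy : ∀ f1 f2 f3 : SS k, π (EE t k h (t ^ k * f1) (t ^ k * f2) (t ^ k * f3) 0 0 0 0) ∈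
      gammaGrp (Gam (SS k) t k h ⧸ KK (SS k) t k h) (k + 3 - 2) := by
    intro f1 f2 f3
    unfold gammaGrp
    rw [hmap]
    exact Subgroup.mem_map_of_mem _ (t_mem ht f1 f2 f3 k)
  let a1 : Gam (SS k) t k h := EE t k h 0 0 0 0 1 0 0
  let a2 : Gam (SS k) t k h := EE t k h 0 0 0 0 0 1 0
  let a3 : Gam (SS k) t k h := EE t k h 0 0 0 0 0 0 1
  let y1 : Gam (SS k) t k h := EE t k h (t ^ k) 0 0 0 0 0 0
  let y2 : Gam (SS k) t k h := EE t k h 0 (t ^ k) 0 0 0 0 0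
  let y3 : Gam (SS k) t k h := EE t k h 0 0 (t ^ k) 0 0 0 0
  have hy1 : π y1 ∈ gammaGrp (Gam (SS k) t k h ⧸ KK (SS k) t k h) (k + 3 - 2) := by simpa using hy 1 0 0
  have hy2 : π y2 ∈ gammaGrp (Gam (SS k) t k h ⧸ KK (SS k) t k h) (k + 3 - 2) := by simpa using hy 0 1 0
  have hy3 : π y3 ∈ gammaGrp (Gam (SS k) t k h ⧸ KK (SS k) t k h) (k + 3 - 2) := by simpa using hy 0 0 1
  have heq : ∀ a b : Gam (SS k) t k h, a⁻¹ * b ∈ (KK (SS k) t k h) → π a = π b := fun a b hab => QuotientGroup.eq.mpr hab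
  have hmem : ∀ (f1 f2 f3 g : SS k) (x1 x2 x3 : ℤ), (∃ (α1 α2 α3 : ℤ) (p1 p2 p3 q : SS k),
    x1 = h * α1 ∧ x2 = h ^ 2 * α2 ∧ x3 = h ^ 3 * α3 ∧
    f1 = (α2 + 2 * α3) * t ^ k + h * p1 ∧ f2 = (-α1 + h * α3) * t ^ k + h ^ 2 * p2 ∧
    f3 = (-2 * α1 - h * α2) * t ^ k + h ^ 3 * p3 ∧ g = h ^ 5 * q) ↔
      EE t k h f1 f2 f3 g x1 x2 x3 ∈ (KK (SS k) t k h) := by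
    intro f1 f2 f3 g x1 x2 x3
    exact ⟨fun hx => ⟨rfl, hx⟩, fun hx => hx.2⟩
  have r1 : (π a1) ^ (4 * H) = π y2 * (π y3) ^ 2 := by
    rw [← map_pow, ← map_pow, ← map_mul]
    apply heq
    simp only [a1, y2, y3, A1_pow, F_pow, EE_mul, EE_inv]
    rw [← hmem]
    refine ⟨-1, 0, 0, 0, 0, 0, 0, ?_⟩
    refine ⟨?_, ?_, ?_, ?_, ?_, ?_, ?_⟩ <;> simp [om, hh] <;> ring
  have r2 : (π a2) ^ (16 * H ^ 2) = (π y1)⁻¹ * (π y3) ^ (4 * H) := by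
    rw [← map_pow, ← map_pow, ← map_inv, ← map_mul]
    apply heq
    simp only [a2, y1, y3, A2_pow, F_pow, EE_mul, EE_inv]
    rw [← hmem]
    refine ⟨0, -1, 0, 0, 0, 0, 0, ?_⟩
    refine ⟨?_, ?_, ?_, ?_, ?_, ?_, ?_⟩ <;> simp [om, hh] <;> ring
  have r3 : (π a3) ^ (64 * H ^ 3) = ((π y1) ^ 2)⁻¹ * ((π y2) ^ (4 * H))⁻¹ := by
    rw [← map_pow, ← map_pow, ← map_pow, ← map_inv, ← map_inv, ← map_mul]
    apply heq
    simp only [a3, y1, y2, A3_pow, F_pow, EE_mul, EE_inv]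
    rw [← hmem]
    refine ⟨0, 0, -1, 0, 0, 0, 0, ?_⟩
    refine ⟨?_, ?_, ?_, ?_, ?_, ?_, ?_⟩ <;> simp [om, hh] <;> ring
  have o1 : (π y1) ^ (4 * H) = 1 := by
    rw [← map_pow]
    apply (QuotientGroup.eq_one_iff _).mpr
    simp only [y1, F_pow]
    refine (hmem _ _ _ _ _ _ _).1 ⟨0, 0, 0, t ^ k, 0, 0, 0, ?_⟩
    refine ⟨?_, ?_, ?_, ?_, ?_, ?_, ?_⟩ <;> simp [om, hh] <;> ring
  have o2 : (π y2) ^ (16 * H ^ 2) = 1 := by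
    rw [← map_pow]
    apply (QuotientGroup.eq_one_iff _).mpr
    simp only [y2, F_pow]
    refine (hmem _ _ _ _ _ _ _).1 ⟨0, 0, 0, 0, t ^ k, 0, 0, ?_⟩
    refine ⟨?_, ?_, ?_, ?_, ?_, ?_, ?_⟩ <;> simp [om, hh] <;> ring
  have hw : ⁅(π y2) ^ (8 * H ^ 2), π a2⁆ =
      π (EE t k h 0 0 0 (-(h ^ 3 * (8 * H ^ 2 : ℕ) * t ^ k)) 0 0 0) := by
    rw [← map_pow, ← map_commutatorElement, comm_w]
  refine ⟨Gam (SS k) t k h ⧸ KK (SS k) t k h, inferInstance, ⁅(π y2) ^ (8 * H ^ 2), π a2⁆,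
    part_one (k + 3) hn (k + 3) H le_rfl hH _ _ _ _ _ _ hy1 hy2 hy3 r1 r2 r3 o1 o2, ?_, ?_⟩
  · rw [hbot, Subgroup.mem_bot, hw]
    intro hc
    replace hc := (QuotientGroup.eq_one_iff _).mp hc
    rw [← hmem] at hc
    obtain ⟨_, _, _, _, _, _, q, _, _, _, _, _, _, hq⟩ := hc
    have := tt_dvd k (-(h ^ 3 * (8 * H ^ 2 : ℕ))) (h ^ 5) q (by
      push_cast at hq ⊢
      rw [← hq, htt]; ring)
    rw [dvd_neg, pow_add h 3 2] at this
    have h2 := Int.dvd_of_mul_dvd_mul_left (a := h ^ 3) (by positivity) this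
    rw [hh] at h2
    push_cast at h2
    have := Int.le_of_dvd (by positivity) h2
    have : (0 : ℤ) < (H : ℤ) ^ 2 := by positivity
    nlinarith
  · rw [hbot, Subgroup.mem_bot, hw, ← map_pow, F_pow]
    apply (QuotientGroup.eq_one_iff _).mpr
    refine (hmem _ _ _ _ _ _ _).1 ⟨0, 0, 0, 0, 0, 0, -t ^ k, ?_⟩
    refine ⟨?_, ?_, ?_, ?_, ?_, ?_, ?_⟩ <;> simp [om, hh] <;> ring
end PartThree

/-- For every `n ≥ 4` there exist a group `G` and `g ∈ G` with `g ∈ δ_n(G)`,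
`g ∉ γ_n(G)` and `g² ∈ γ_n(G)`: the dimension quotient `δ_n(G)/γ_n(G)` contains
an element of order `2`. -/
theorem dimension_quotient_contains_two_torsion (n : ℕ) (hn : 4 ≤ n) :
    ∃ (G : Type) (_ : Group G) (g : G),
      g ∈ dimensionSubgroup G n ∧ g ∉ gammaGrp G n ∧ g ^ 2 ∈ gammaGrp G n := by
  exact main_thm n hn
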